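/- The generalized Petersen graph GP(13,2) has exactly 79 perfect matchings; exactly one of them has forcing number 4 and the other 78 have forcing number 3 (forcing polynomial x^4 + 78x^3). -/

import Mathlib

open SimpleGraph

/-- The generalized Petersen graph `GP(n,k)`: vertices `u i = Sum.inl i`,
`v i = Sum.inr i`, edges `u i -- u (i+k)`, `u i -- v i`, `v i -- v (i+1)` (mod n). -/
def GP (n k : ℕ) : SimpleGraph (Fin n ⊕ Fin n) :=
  SimpleGraph.fromRel (fun a b =>
    match a, b with
    | Sum.inl i, Sum.inl j => (j : ℕ) = ((i : ℕ) + k) % n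
    | Sum.inl i, Sum.inr j => i = j
    | Sum.inr i, Sum.inr j => (j : ℕ) = ((i : ℕ) + 1) % n
    | _, _ => False)

/-- `S` is a forcing set of the perfect matching `M` of `G`:
`S` consists of edges of `M` and `M` is the unique perfect matching containing `S`. -/
def IsForcingSet {V : Type*} (G : SimpleGraph V) (M : G.Subgraph) (S : Set (Sym2 V)) : Prop :=
  S ⊆ M.edgeSet ∧
    ∀ M' : G.Subgraph, M'.IsPerfectMatching → S ⊆ M'.edgeSet → M' = M

/-- The forcing number `f(G,M)`: minimum cardinality of a forcing set of `M`. -/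
noncomputable def forcingNum {V : Type*} (G : SimpleGraph V) (M : G.Subgraph) : ℕ :=
  sInf {k | ∃ S : Set (Sym2 V), IsForcingSet G M S ∧ S.ncard = k}

/-- A cycle `p` of `G` is `M`-alternating: its edges lie alternately in `M` and outside `M`.
For a perfect matching `M` this is equivalent to saying that every vertex of the
cycle is covered by an edge of `M` lying on the cycle. -/
def IsAltCycle {V : Type*} (G : SimpleGraph V) (M : G.Subgraph) {v : V} (p : G.Walk v v) : Prop :=
  p.IsCycle ∧ ∀ u ∈ p.support, ∃ e ∈ p.edges, e ∈ M.edgeSet ∧ u ∈ e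

/-- `C(G,M)`: the maximum number of pairwise vertex-disjoint `M`-alternating cycles of `G`. -/
noncomputable def maxDisjAltCycles {V : Type*} (G : SimpleGraph V) (M : G.Subgraph) : ℕ :=
  sSup {k | ∃ c : Fin k → Σ v : V, G.Walk v v,
    (∀ i, IsAltCycle G M (c i).2) ∧
    Pairwise fun i j => List.Disjoint (c i).2.support (c j).2.support}

namespace GPaux

abbrev V := Fin 13 ⊕ Fin 13

/-- The 39 edges: index `3i` is the spoke, `3i+1` the `v`-edge, `3i+2` the `u`-edge at `i`. -/
def ed (k : Fin 39) : Sym2 V :=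
  let i : Fin 13 := ⟨k.val / 3, by omega⟩
  if k.val % 3 = 0 then s(Sum.inl i, Sum.inr i)
  else if k.val % 3 = 1 then s(Sum.inr i, Sum.inr (i + 1))
  else s(Sum.inl i, Sum.inl (i + 2))

/-- Indices of the edges at `u i`. -/
def tu (i : ℕ) : ℕ × ℕ × ℕ := (3 * i, 3 * i + 2, (3 * i + 35) % 39)

/-- Indices of the edges at `v i`. -/
def tv (i : ℕ) : ℕ × ℕ × ℕ := (3 * i, 3 * i + 1, (3 * i + 37) % 39)

def trip (v : V) : ℕ × ℕ × ℕ :=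
  match v with
  | Sum.inl i => tu i
  | Sum.inr i => tv i

theorem mem_ed : ∀ (v : V) (k : Fin 39),
    v ∈ ed k ↔ (k.val = (trip v).1 ∨ k.val = (trip v).2.1 ∨ k.val = (trip v).2.2) := by
  decide +kernel

theorem trip_lt : ∀ v : V, ((trip v).1 < 39 ∧ (trip v).2.1 < 39 ∧ (trip v).2.2 < 39) ∧
    (trip v).1 ≠ (trip v).2.1 ∧ (trip v).1 ≠ (trip v).2.2 ∧ (trip v).2.1 ≠ (trip v).2.2 := by
  decide +kernel

theorem ed_inj : Function.Injective ed := by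
  have : ∀ k l : Fin 39, ed k = ed l → k = l := by decide +kernel
  exact fun k l => this k l

instance : DecidableRel (GP 13 2).Adj := fun a b => by
  unfold GP
  rw [SimpleGraph.fromRel_adj]
  rcases a with i | i <;> rcases b with j | j <;> simp only <;> infer_instance

theorem adj_ed : ∀ x y : V, (GP 13 2).Adj x y → ∃ k, ed k = s(x, y) := by
  decide +kernel

theorem ed_mem : ∀ k, ed k ∈ (GP 13 2).edgeSet := by
  decide +kernel

theorem adj_iff (x y : V) : (GP 13 2).Adj x y ↔ ∃ k, ed k = s(x, y) := by
  refine ⟨adj_ed x y, ?_⟩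
  rintro ⟨k, hk⟩
  rw [← SimpleGraph.mem_edgeSet, ← hk]
  exact ed_mem k

theorem edge_eq {M : (GP 13 2).Subgraph} {x y : V} (h : M.Adj x y) : ∃ k, ed k = s(x, y) :=
  (adj_iff x y).1 h.adj_sub

/-- exactly one of the three bits is set -/
def ex1 (t : ℕ × ℕ × ℕ) (m : ℕ) : Bool :=
  let a := m.testBit t.1
  let b := m.testBit t.2.1
  let c := m.testBit t.2.2
  (a && !b && !c) || (!a && b && !c) || (!a && !b && c)

/-- consistency of the bits up to `k` -/
def good (k : ℕ) (t : ℕ × ℕ × ℕ) (m : ℕ) : Bool :=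
  let a := m.testBit t.1
  let b := m.testBit t.2.1
  let c := m.testBit t.2.2
  !(a && b) && !(a && c) && !(b && c) &&
    (a || b || c || Nat.blt k t.1 || Nat.blt k t.2.1 || Nat.blt k t.2.2)

theorem good_of_ex1 {k : ℕ} {t : ℕ × ℕ × ℕ} {m : ℕ} (h : ex1 t m = true) :
    good k t (m % 2 ^ (k + 1)) = true := by
  obtain ⟨a, b, c⟩ := t
  simp only [ex1, good, Nat.testBit_mod_two_pow] at *
  have e : ∀ x, Nat.blt k x = !decide (x < k + 1) := by
    intro x
    rw [Bool.eq_iff_iff, Nat.blt_eq]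
    simp
  rw [e, e, e]
  revert h
  generalize decide (a < k + 1) = p
  generalize decide (b < k + 1) = q
  generalize decide (c < k + 1) = r
  generalize m.testBit a = x
  generalize m.testBit b = y
  generalize m.testBit c = z
  revert p q r x y z
  decide

def ck (k : ℕ) : List (ℕ × ℕ × ℕ) :=
  let i := k / 3
  match k % 3 with
  | 0 => [tu i, tv i]
  | 1 => [tv i, tv ((i + 1) % 13)]
  | _ => [tu i, tu ((i + 2) % 13)]

def stage : ℕ → List ℕ
  | 0 => [0]
  | k + 1 => (stage k).flatMap fun x => [x, x + 2 ^ k].filter fun y => (ck k).all fun t => good k t y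

theorem mem_stage {m : ℕ} (h : ∀ v, ex1 (trip v) m = true) : ∀ k ≤ 39, m % 2 ^ k ∈ stage k := by
  have hu : ∀ i < 13, ex1 (tu i) m = true := fun i hi => h (Sum.inl ⟨i, hi⟩)
  have hv : ∀ i < 13, ex1 (tv i) m = true := fun i hi => h (Sum.inr ⟨i, hi⟩)
  intro k
  induction k with
  | zero => intro _; simp [stage, Nat.mod_one]
  | succ k ih =>
    intro hk
    have h1 := ih (by omega)
    rw [stage, List.mem_flatMap]
    refine ⟨_, h1, ?_⟩
    rw [List.mem_filter]
    constructor
    · have : m % 2 ^ (k + 1) = m % 2 ^ k + 2 ^ k * (m / 2 ^ k % 2) := by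
        rw [pow_succ, Nat.mod_mul]
      rcases Nat.mod_two_eq_zero_or_one (m / 2 ^ k) with h2 | h2 <;> rw [h2] at this <;>
        simp [this]
    · rw [List.all_eq_true]
      intro t ht
      apply good_of_ex1
      unfold ck at ht
      simp only at ht
      split at ht <;> simp only [List.mem_cons, List.not_mem_nil, or_false] at ht <;>
        rcases ht with rfl | rfl <;> first | (apply hu; omega) | (apply hv; omega)

/-- The list of all perfect matchings, as bit masks. -/
def L : List ℕ := [
   449030005520, 178380801328, 178284692784, 178394531120, 178284669320, 178394507656,
   178394319944, 178392818248, 178380804680, 178284696136, 178394534472, 421255007252,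
   415104060436, 422133713940, 415102558740, 422132212244, 422120198676, 422024090132,
   421255221780, 415104274964, 422133928468, 150618031156, 150618007692, 150605994124,
   144455047308, 327534782850, 326765914498, 327644621186, 326765726786, 327644433474,
   327642931778, 327630918210, 327534809666, 326765941314, 327644648002, 105432621474,
   105432433762, 105336325218, 56128750690, 293705160838, 71505174694, 22297600166, 78534828198,
   22285586598, 78522814630, 78426706086, 77657837734, 71506890918, 22299316390, 78536544422,
   293705157905, 293703656209, 292934787857, 22285583665, 78522811697, 78426703153, 77657834801,
   71506887985, 22299313457, 78536541489, 78426679689, 77657811337, 71506864521, 22299289993,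
   78536518025, 77657623625, 71506676809, 22299102281, 78536330313, 71505175113, 22297600585,
   78534828617, 22285587017, 78522815049, 78426706505, 77657838153, 71506891337, 22299316809,
   78536544841]

theorem stage_eq : stage 39 = L := by decide +kernel

theorem L_lt : ∀ m ∈ L, m < 2 ^ 39 := by decide +kernel

theorem L_ex1 : ∀ m ∈ L, ∀ v, ex1 (trip v) m = true := by decide +kernel

theorem L_nodup : L.Nodup := by decide +kernel

open Classical in
noncomputable def mask (M : (GP 13 2).Subgraph) : ℕ :=
  Nat.ofBits (fun k : Fin 39 => decide (ed k ∈ M.edgeSet))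

theorem mask_bit (M : (GP 13 2).Subgraph) (k : Fin 39) :
    (mask M).testBit k = true ↔ ed k ∈ M.edgeSet := by
  classical
  simp [mask]

theorem mask_lt (M : (GP 13 2).Subgraph) : mask M < 2 ^ 39 := Nat.ofBits_lt_two_pow _

theorem pm_iff (M : (GP 13 2).Subgraph) :
    M.IsPerfectMatching ↔ ∀ v, ∃! k, v ∈ ed k ∧ ed k ∈ M.edgeSet := by
  rw [Subgraph.isPerfectMatching_iff]
  refine forall_congr' fun v => ?_
  constructor
  · rintro ⟨w, hw, hu⟩
    obtain ⟨k, hk⟩ := edge_eq hw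
    refine ⟨k, ⟨by simp [hk], by rw [hk]; exact hw⟩, ?_⟩
    rintro l ⟨hl, hl2⟩
    obtain ⟨y, hy⟩ := hl
    rw [hy, Subgraph.mem_edgeSet] at hl2
    apply ed_inj
    rw [hk, hy, hu y hl2]
  · rintro ⟨k, ⟨⟨w, hw⟩, hk⟩, hu⟩
    refine ⟨w, by rw [hw] at hk; exact hk, ?_⟩
    intro y hy
    obtain ⟨l, hl⟩ := edge_eq hy
    have := hu l ⟨by simp [hl], by rw [hl]; exact hy⟩
    subst this
    rw [hw] at hl
    exact (Sym2.congr_right.1 hl).symm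

theorem pm_iff_ex1 (M : (GP 13 2).Subgraph) :
    M.IsPerfectMatching ↔ ∀ v, ex1 (trip v) (mask M) = true := by
  rw [pm_iff]
  refine forall_congr' fun v => ?_
  have hm := mem_ed v
  obtain ⟨⟨ha, hb, hc⟩, hab, hac, hbc⟩ := trip_lt v
  generalize trip v = t at *
  obtain ⟨a, b, c⟩ := t
  simp only at *
  have A := mask_bit M ⟨a, ha⟩
  have B := mask_bit M ⟨b, hb⟩
  have C := mask_bit M ⟨c, hc⟩
  simp only at A B C
  have key : ex1 (a, b, c) (mask M) = true ↔
      ((mask M).testBit a = true ∧ ¬ (mask M).testBit b = true ∧ ¬ (mask M).testBit c = true) ∨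
      (¬ (mask M).testBit a = true ∧ (mask M).testBit b = true ∧ ¬ (mask M).testBit c = true) ∨
      (¬ (mask M).testBit a = true ∧ ¬ (mask M).testBit b = true ∧ (mask M).testBit c = true) := by
    simp only [ex1]
    generalize (mask M).testBit a = x
    generalize (mask M).testBit b = y
    generalize (mask M).testBit c = z
    revert x y z
    decide
  rw [key]
  constructor
  · rintro ⟨k, ⟨h1, h2⟩, h3⟩
    have h3a := h3 ⟨a, ha⟩
    have h3b := h3 ⟨b, hb⟩
    have h3c := h3 ⟨c, hc⟩
    simp only [hm, ← A, ← B, ← C, true_or, or_true, true_and, Fin.ext_iff] at h1 h3a h3b h3c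
    have h2' := (mask_bit M k).2 h2
    rcases h1 with h1 | h1 | h1 <;> rw [h1] at h2' h3a h3b h3c <;> grind
  · have main : ∀ x (hx : x < 39), (x = a ∨ x = b ∨ x = c) → (mask M).testBit x = true →
        (∀ y, y < 39 → (y = a ∨ y = b ∨ y = c) → (mask M).testBit y = true → y = x) →
        ∃! k, v ∈ ed k ∧ ed k ∈ M.edgeSet := by
      intro x hx h1 h2 h3
      refine ⟨⟨x, hx⟩, ⟨(hm _).2 h1, (mask_bit M _).1 h2⟩, ?_⟩
      rintro l ⟨hl, hl2⟩
      exact Fin.ext (h3 l l.2 ((hm _).1 hl) ((mask_bit M _).2 hl2))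
    rintro (h | h | h)
    · exact main a ha (by simp) h.1 (by grind)
    · exact main b hb (by simp) h.2.1 (by grind)
    · exact main c hc (by simp) h.2.2 (by grind)

theorem mask_mem {M : (GP 13 2).Subgraph} (h : M.IsPerfectMatching) : mask M ∈ L := by
  have := mem_stage ((pm_iff_ex1 M).1 h) 39 le_rfl
  rwa [Nat.mod_eq_of_lt (mask_lt M), stage_eq] at this

theorem mask_inj {M N : (GP 13 2).Subgraph} (hM : M.IsPerfectMatching)
    (hN : N.IsPerfectMatching) (h : mask M = mask N) : M = N := by
  have key : ∀ {M N : (GP 13 2).Subgraph}, mask M = mask N → ∀ x y, M.Adj x y → N.Adj x y := by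
    intro M N h x y hxy
    obtain ⟨k, hk⟩ := edge_eq hxy
    rw [← Subgraph.mem_edgeSet, ← hk, ← mask_bit] at hxy ⊢
    rwa [← h]
  apply Subgraph.ext
  · rw [hM.2.verts_eq_univ, hN.2.verts_eq_univ]
  · ext x y
    exact ⟨key h x y, key h.symm x y⟩

/-- The subgraph with a given bit mask. -/
def ofMask (m : ℕ) : (GP 13 2).Subgraph where
  verts := Set.univ
  Adj x y := ∃ k : Fin 39, ed k = s(x, y) ∧ m.testBit k = true
  adj_sub := by
    rintro x y ⟨k, hk, _⟩
    exact (adj_iff x y).2 ⟨k, hk⟩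
  edge_vert := fun _ => Set.mem_univ _
  symm := ⟨by
    rintro x y ⟨k, hk, h⟩
    exact ⟨k, by rw [hk, Sym2.eq_swap], h⟩⟩

theorem mask_ofMask {m : ℕ} (hm : m < 2 ^ 39) : mask (ofMask m) = m := by
  apply Nat.eq_of_testBit_eq
  intro i
  by_cases hi : i < 39
  · rw [Bool.eq_iff_iff]
    have := mask_bit (ofMask m) ⟨i, hi⟩
    simp only at this
    rw [this]
    generalize hk : (⟨i, hi⟩ : Fin 39) = k
    have hik : i = k := by rw [← hk]
    rw [hik]
    induction he : ed k using Sym2.ind with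
    | _ x y =>
      rw [Subgraph.mem_edgeSet]
      constructor
      · rintro ⟨l, hl, h⟩
        rwa [← ed_inj (hl.trans he.symm)]
      · exact fun h => ⟨k, he, h⟩
  · have : 2 ^ 39 ≤ 2 ^ i := Nat.pow_le_pow_right (by norm_num) (by omega)
    rw [Nat.testBit_lt_two_pow (lt_of_lt_of_le (mask_lt _) this),
      Nat.testBit_lt_two_pow (lt_of_lt_of_le hm this)]

theorem ofMask_pm {m : ℕ} (hm : m ∈ L) : (ofMask m).IsPerfectMatching := by
  rw [pm_iff_ex1, mask_ofMask (L_lt m hm)]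
  exact L_ex1 m hm

/-- Is there a set of at most `k` indices meeting all the bit masks in the list? -/
def hit : ℕ → List ℕ → Bool
  | _, [] => true
  | 0, _ :: _ => false
  | k + 1, D :: Ds => (List.range 39).any fun e =>
      D.testBit e && hit k (Ds.filter fun x => !x.testBit e)

theorem hit_complete : ∀ (k : ℕ) (Ds : List ℕ) (T : Finset ℕ), T.card ≤ k → (∀ e ∈ T, e < 39) →
    (∀ D ∈ Ds, ∃ e ∈ T, D.testBit e = true) → hit k Ds = true := by
  intro k
  induction k with
  | zero =>
    intro Ds T hT _ h
    cases Ds with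
    | nil => rfl
    | cons D Ds =>
      obtain ⟨e, he, _⟩ := h D (by simp)
      rw [Finset.card_eq_zero.1 (Nat.le_zero.1 hT)] at he
      simp at he
  | succ k ih =>
    intro Ds T hT hlt h
    cases Ds with
    | nil => rfl
    | cons D Ds =>
      obtain ⟨e, he, hD⟩ := h D (by simp)
      rw [hit, List.any_eq_true]
      refine ⟨e, List.mem_range.2 (hlt e he), ?_⟩
      rw [hD, Bool.true_and]
      apply ih _ (T.erase e)
      · rw [Finset.card_erase_of_mem he]; omega
      · exact fun x hx => hlt x (Finset.mem_of_mem_erase hx)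
      · intro D' hD'
        rw [List.mem_filter] at hD'
        obtain ⟨f, hf, hf2⟩ := h D' (by simp [hD'.1])
        refine ⟨f, Finset.mem_erase.2 ⟨?_, hf⟩, hf2⟩
        rintro rfl
        simp [hf2] at hD'

theorem hit_sound : ∀ (k : ℕ) (Ds : List ℕ), hit k Ds = true →
    ∃ T : Finset ℕ, T.card ≤ k ∧ (∀ e ∈ T, e < 39 ∧ ∃ D ∈ Ds, D.testBit e = true) ∧
    ∀ D ∈ Ds, ∃ e ∈ T, D.testBit e = true := by
  intro k
  induction k with
  | zero =>
    intro Ds h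
    cases Ds with
    | nil => exact ⟨∅, by simp⟩
    | cons D Ds => simp [hit] at h
  | succ k ih =>
    intro Ds h
    cases Ds with
    | nil => exact ⟨∅, by simp⟩
    | cons D Ds =>
      rw [hit, List.any_eq_true] at h
      obtain ⟨e, he, h⟩ := h
      rw [Bool.and_eq_true] at h
      obtain ⟨T, hT, h1, h2⟩ := ih _ h.2
      refine ⟨insert e T, (Finset.card_insert_le _ _).trans (by omega), ?_, ?_⟩
      · intro f hf
        rcases Finset.mem_insert.1 hf with rfl | hf
        · exact ⟨List.mem_range.1 he, D, by simp, h.1⟩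
        · obtain ⟨hlt, D', hD', hb⟩ := h1 f hf
          exact ⟨hlt, D', List.mem_cons_of_mem _ (List.mem_filter.1 hD').1, hb⟩
      · intro D' hD'
        rcases List.mem_cons.1 hD' with rfl | hD'
        · exact ⟨e, by simp, h.1⟩
        · by_cases hb : D'.testBit e = true
          · exact ⟨e, by simp, hb⟩
          · obtain ⟨f, hf, hf2⟩ := h2 D' (List.mem_filter.2 ⟨hD', by simpa using hb⟩)
            exact ⟨f, Finset.mem_insert_of_mem hf, hf2⟩

theorem not_beq {x m : ℕ} : (!Nat.beq x m) = true ↔ x ≠ m := by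
  rw [Bool.not_eq_true', ← Bool.not_eq_true, Nat.beq_eq]

/-- The difference masks of `m` with all other perfect matchings. -/
def diffs (m : ℕ) : List ℕ := (L.filter fun x => !Nat.beq x m).map fun x => m &&& (m ^^^ x)

theorem mem_diffs {m D : ℕ} : D ∈ diffs m ↔ ∃ x ∈ L, x ≠ m ∧ m &&& (m ^^^ x) = D := by
  simp only [diffs, List.mem_map, List.mem_filter, not_beq, and_assoc]

theorem diff_bit {m x e : ℕ} :
    (m &&& (m ^^^ x)).testBit e = true ↔ m.testBit e = true ∧ ¬ x.testBit e = true := by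
  rw [Nat.testBit_land, Nat.testBit_xor]
  generalize m.testBit e = a
  generalize x.testBit e = b
  revert a b
  decide

theorem hit_of_forcing {M : (GP 13 2).Subgraph} {S : Set (Sym2 V)}
    (hS : IsForcingSet (GP 13 2) M S) {k : ℕ} (hk : S.ncard ≤ k) :
    hit k (diffs (mask M)) = true := by
  classical
  let T : Finset (Fin 39) := Finset.univ.filter fun k => ed k ∈ S
  apply hit_complete k _ (T.map Fin.valEmbedding)
  · rw [Finset.card_map]
    refine le_trans ?_ hk
    rw [← Set.ncard_coe_finset, ← Set.ncard_image_of_injective _ ed_inj]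
    apply Set.ncard_le_ncard _ (Set.toFinite _)
    rintro _ ⟨k, hk, rfl⟩
    simpa [T] using hk
  · intro e he
    obtain ⟨k, _, rfl⟩ := Finset.mem_map.1 he
    exact k.2
  · intro D hD
    obtain ⟨x, hx, hne, rfl⟩ := mem_diffs.1 hD
    by_contra hcon
    apply hne
    have hmx := mask_ofMask (L_lt x hx)
    rw [← hmx]
    congr 1
    apply hS.2 _ (ofMask_pm hx)
    intro e he
    have heM := hS.1 he
    obtain ⟨k, rfl⟩ : ∃ k, ed k = e := by
      induction e using Sym2.ind with
      | _ a b => exact edge_eq heM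
    rw [← mask_bit, hmx]
    by_contra hb
    exact hcon ⟨k, Finset.mem_map.2 ⟨k, by simpa [T] using he, rfl⟩, diff_bit.2 ⟨(mask_bit M k).2 heM, hb⟩⟩

theorem forcing_of_hit {M : (GP 13 2).Subgraph} (hM : M.IsPerfectMatching) {k : ℕ}
    (h : hit k (diffs (mask M)) = true) :
    ∃ S, IsForcingSet (GP 13 2) M S ∧ S.ncard ≤ k := by
  classical
  obtain ⟨T, hT, h1, h2⟩ := hit_sound _ _ h
  let g : ℕ → Sym2 V := fun e => if h : e < 39 then ed ⟨e, h⟩ else ed 0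
  have hg : ∀ k : Fin 39, g k = ed k := fun k => by simp [g]
  refine ⟨(T.image g : Finset (Sym2 V)), ⟨?_, ?_⟩, ?_⟩
  · intro e he
    obtain ⟨f, hf, rfl⟩ := Finset.mem_image.1 (Finset.mem_coe.1 he)
    obtain ⟨hlt, D, hD, hb⟩ := h1 f hf
    obtain ⟨x, hx, hne, rfl⟩ := mem_diffs.1 hD
    have := (mask_bit M ⟨f, hlt⟩).1 (diff_bit.1 hb).1
    rwa [← hg] at this
  · intro N hN hS
    apply mask_inj hN hM
    by_contra hne
    obtain ⟨f, hf, hb⟩ := h2 _ (mem_diffs.2 ⟨mask N, mask_mem hN, hne, rfl⟩)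
    obtain ⟨hlt, _⟩ := h1 f hf
    apply (diff_bit.1 hb).2
    have := hS (Finset.mem_coe.2 (Finset.mem_image_of_mem g hf))
    exact (mask_bit N ⟨f, hlt⟩).2 (by rwa [← hg])
  · rw [Set.ncard_coe_finset]
    exact Finset.card_image_le.trans hT

theorem forcingNum_eq {M : (GP 13 2).Subgraph} (hM : M.IsPerfectMatching) {k : ℕ}
    (h1 : hit k (diffs (mask M)) = false) (h2 : hit (k + 1) (diffs (mask M)) = true) :
    forcingNum (GP 13 2) M = k + 1 := by
  obtain ⟨S, hS, hk⟩ := forcing_of_hit hM h2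
  unfold forcingNum
  apply le_antisymm
  · exact le_trans (Nat.sInf_le (m := S.ncard) ⟨S, hS, rfl⟩) hk
  · obtain ⟨S', hS', hc⟩ := Nat.sInf_mem
      (s := {k | ∃ S : Set (Sym2 V), IsForcingSet (GP 13 2) M S ∧ S.ncard = k}) ⟨_, S, hS, rfl⟩
    rw [← hc]
    by_contra hlt
    rw [hit_of_forcing hS' (k := k) (by omega)] at h1
    cases h1

/-- The exceptional perfect matching. -/
def m0 : ℕ := 78536544841

theorem m0_mem : m0 ∈ L := by decide +kernel

theorem hit_m0 : hit 3 (diffs m0) = false ∧ hit 4 (diffs m0) = true := by decide +kernel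

theorem hit_other : ∀ m ∈ L.filter (fun x => !Nat.beq x m0),
    hit 2 (diffs m) = false ∧ hit 3 (diffs m) = true := by decide +kernel

theorem forcing_m0 {M : (GP 13 2).Subgraph} (hM : M.IsPerfectMatching) (h : mask M = m0) :
    forcingNum (GP 13 2) M = 4 :=
  forcingNum_eq hM (by rw [h]; exact hit_m0.1) (by rw [h]; exact hit_m0.2)

theorem forcing_other {M : (GP 13 2).Subgraph} (hM : M.IsPerfectMatching) (h : mask M ≠ m0) :
    forcingNum (GP 13 2) M = 3 := by
  have := hit_other (mask M) (List.mem_filter.2 ⟨mask_mem hM, not_beq.2 h⟩)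
  exact forcingNum_eq hM this.1 this.2

theorem ncard_of (P : (GP 13 2).Subgraph → Prop) (F : Finset ℕ)
    (hF : ∀ m ∈ F, m ∈ L)
    (h : ∀ M : (GP 13 2).Subgraph, M.IsPerfectMatching → (P M ↔ mask M ∈ F)) :
    {M : (GP 13 2).Subgraph | M.IsPerfectMatching ∧ P M}.ncard = F.card := by
  rw [← Set.ncard_coe_finset, ← Set.InjOn.ncard_image (f := mask)]
  · congr 1
    ext m
    constructor
    · rintro ⟨M, ⟨hM, hP⟩, rfl⟩
      exact (h M hM).1 hP
    · intro hm
      have hL := hF m hm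
      have e := mask_ofMask (L_lt m hL)
      exact ⟨ofMask m, ⟨ofMask_pm hL, (h _ (ofMask_pm hL)).2 (by rw [e]; exact hm)⟩, e⟩
  · intro M hM N hN
    exact mask_inj hM.1 hN.1

theorem card_L : L.toFinset.card = 79 := by
  rw [List.toFinset_card_of_nodup L_nodup]
  rfl

end GPaux

theorem stmt18 :
    {M : (GP 13 2).Subgraph | M.IsPerfectMatching}.ncard = 79 ∧
    {M : (GP 13 2).Subgraph | M.IsPerfectMatching ∧ forcingNum (GP 13 2) M = 4}.ncard = 1 ∧
    {M : (GP 13 2).Subgraph | M.IsPerfectMatching ∧ forcingNum (GP 13 2) M = 3}.ncard = 78 := by 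
  open GPaux in
  refine ⟨?_, ?_, ?_⟩
  · have := ncard_of (fun _ => True) L.toFinset (by simp)
      (fun M hM => by simpa using mask_mem hM)
    rw [card_L] at this
    simpa using this
  · rw [ncard_of (fun M => forcingNum (GP 13 2) M = 4) {m0} (by simp [m0_mem])]
    · simp
    · intro M hM
      by_cases h : mask M = m0
      · simp [h, forcing_m0 hM h]
      · simp [h, forcing_other hM h]
  · rw [ncard_of (fun M => forcingNum (GP 13 2) M = 3) (L.toFinset.erase m0) (by simp)]
    · rw [Finset.card_erase_of_mem (by simp [m0_mem]), card_L]
    · intro M hM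
      by_cases h : mask M = m0
      · simp [h, forcing_m0 hM h]
      · simp [h, forcing_other hM h, mask_mem hM]
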